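/- (Proposition 2, quantum instantiation: a POVM is separable if and only if it is partially transformable.) Let e be a POVM on the bipartite system. Then e is separable if and only if for every a' : ℕ and every ℂ-linear map Ψ : Matrix (Fin a) (Fin a) ℂ →ₗ[ℂ] Matrix (Fin a') (Fin a') ℂ that is Hermitian-preserving, positive, and unital, the matrix (Ψ ⊗ id) (e m) is positive semidefinite for every m. -/

import Mathlib

open Matrix ComplexOrder Kronecker

/-- A matrix on the bipartite system `Fin a × Fin b` is separable if it is a finite
sum of Kronecker products of positive semidefinite matrices. -/
def Matrix.IsSeparable {a b : ℕ} (E : Matrix (Fin a × Fin b) (Fin a × Fin b) ℂ) : Prop :=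
  ∃ (ι : Type) (_ : Fintype ι) (A : ι → Matrix (Fin a) (Fin a) ℂ)
    (B : ι → Matrix (Fin b) (Fin b) ℂ),
    (∀ i, (A i).PosSemidef) ∧ (∀ i, (B i).PosSemidef) ∧ E = ∑ i, (A i) ⊗ₖ (B i)

/-- `(Ψ ⊗ id) E`: the map `Ψ` applied on the first tensor factor. The
`((i',k),(j',l))` entry is `(Ψ E^{(k,l)}) i' j'`, where `E^{(k,l)} i j = E (i,k) (j,l)`. -/
def partialMap {a a' b : ℕ}
    (Ψ : Matrix (Fin a) (Fin a) ℂ →ₗ[ℂ] Matrix (Fin a') (Fin a') ℂ)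
    (E : Matrix (Fin a × Fin b) (Fin a × Fin b) ℂ) :
    Matrix (Fin a' × Fin b) (Fin a' × Fin b) ℂ :=
  Matrix.of fun p q => Ψ (Matrix.of fun i j => E (i, p.2) (j, q.2)) p.1 q.1

/-- In a finite-dimensional real topological vector space, the convex hull of a compact set is
compact. -/
theorem IsCompact.convexHull_of_finiteDimensional {E : Type*} [AddCommGroup E] [Module ℝ E]
    [TopologicalSpace E] [ContinuousAdd E] [ContinuousSMul ℝ E] [FiniteDimensional ℝ E]
    {s : Set E} (hs : IsCompact s) : IsCompact (convexHull ℝ s) := by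
  have key : convexHull ℝ s = ⋃ n ∈ Set.Iic (Module.finrank ℝ E + 1),
      (fun p : (Fin n → ℝ) × (Fin n → E) => ∑ i, p.1 i • p.2 i) ''
        (stdSimplex ℝ (Fin n) ×ˢ Set.univ.pi fun _ => s) := by
    ext x
    simp only [Set.mem_iUnion, Set.mem_image, exists_prop, Prod.exists, Set.mem_prod]
    constructor
    · intro hx
      obtain ⟨ι, _, z, w, hz, hai, hw, hw1, hx⟩ := eq_pos_convex_span_of_mem_convexHull hx
      let σ := (Fintype.equivFin ι).symm
      refine ⟨Fintype.card ι, hai.card_le_finrank_succ.trans ?_, w ∘ σ, z ∘ σ,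
        ⟨⟨fun i => (hw _).le, ?_⟩, fun i _ => hz ⟨_, rfl⟩⟩, ?_⟩
      · gcongr
        exact Submodule.finrank_le _
      · rw [← hw1]
        exact Equiv.sum_comp σ w
      · rw [← hx]
        exact Equiv.sum_comp σ fun i => w i • z i
    · rintro ⟨n, -, w, z, ⟨hw, hz⟩, rfl⟩
      exact mem_convexHull_of_exists_fintype w z hw.1 hw.2 (fun i => hz i trivial) rfl
  rw [key]
  refine (Set.finite_Iic _).isCompact_biUnion fun n _ => ?_
  refine ((isCompact_stdSimplex ℝ (Fin n)).prod (isCompact_univ_pi fun _ => hs)).image ?_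
  fun_prop

theorem partialMap_kronecker {a a' b : ℕ}
    (Ψ : Matrix (Fin a) (Fin a) ℂ →ₗ[ℂ] Matrix (Fin a') (Fin a') ℂ)
    (A : Matrix (Fin a) (Fin a) ℂ) (B : Matrix (Fin b) (Fin b) ℂ) :
    partialMap Ψ (A ⊗ₖ B) = Ψ A ⊗ₖ B := by
  ext p q
  have : (Matrix.of fun i j => (A ⊗ₖ B) (i, p.2) (j, q.2)) = B p.2 q.2 • A := by
    ext i j
    simp [mul_comm]
  rw [partialMap, of_apply, this, map_smul]
  simp [mul_comm]

theorem partialMap_sum {a a' b : ℕ} {ι : Type*} [Fintype ι]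
    (Ψ : Matrix (Fin a) (Fin a) ℂ →ₗ[ℂ] Matrix (Fin a') (Fin a') ℂ)
    (E : ι → Matrix (Fin a × Fin b) (Fin a × Fin b) ℂ) :
    partialMap Ψ (∑ i, E i) = ∑ i, partialMap Ψ (E i) := by
  ext p q
  have : (Matrix.of fun i j => (∑ r, E r) (i, p.2) (j, q.2)) =
      ∑ r, Matrix.of fun i j => E r (i, p.2) (j, q.2) := by
    ext i j
    simp [Matrix.sum_apply]
  rw [partialMap, of_apply, this, map_sum]
  simp [partialMap, Matrix.sum_apply]

theorem Matrix.IsSeparable.partialMap_posSemidef {a a' b : ℕ}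
    {E : Matrix (Fin a × Fin b) (Fin a × Fin b) ℂ} (hE : E.IsSeparable)
    {Ψ : Matrix (Fin a) (Fin a) ℂ →ₗ[ℂ] Matrix (Fin a') (Fin a') ℂ}
    (hΨ : ∀ X : Matrix (Fin a) (Fin a) ℂ, X.PosSemidef → (Ψ X).PosSemidef) :
    (partialMap Ψ E).PosSemidef := by
  obtain ⟨ι, _, A, B, hA, hB, rfl⟩ := hE
  rw [partialMap_sum]
  refine Matrix.posSemidef_sum _ fun i _ => ?_
  rw [partialMap_kronecker]
  exact (hΨ _ (hA i)).kronecker (hB i)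

theorem trace_vecMulVec_star_self {n : ℕ} (v : EuclideanSpace ℂ (Fin n)) :
    (vecMulVec v (star v.ofLp)).trace = (‖v‖ : ℂ) ^ 2 := by
  rw [trace_vecMulVec, ← Complex.ofReal_pow, EuclideanSpace.norm_sq_eq]
  simp [dotProduct, Complex.mul_conj, Complex.normSq_eq_norm_sq]

/-- The pure product states on the bipartite system `Fin a × Fin b`. -/
def pureProductStates (a b : ℕ) : Set (Matrix (Fin a × Fin b) (Fin a × Fin b) ℂ) :=
  (fun p : EuclideanSpace ℂ (Fin a) × EuclideanSpace ℂ (Fin b) =>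
    vecMulVec p.1 (star p.1.ofLp) ⊗ₖ vecMulVec p.2 (star p.2.ofLp)) ''
      (Metric.sphere 0 1 ×ˢ Metric.sphere 0 1)

theorem isCompact_pureProductStates (a b : ℕ) : IsCompact (pureProductStates a b) := by
  refine ((isCompact_sphere _ _).prod (isCompact_sphere _ _)).image ?_
  refine continuous_matrix fun p q => ?_
  simp only [kroneckerMap_apply, vecMulVec_apply, Pi.star_apply]
  fun_prop

theorem trace_of_mem_pureProductStates {a b : ℕ}
    {X : Matrix (Fin a × Fin b) (Fin a × Fin b) ℂ} (hX : X ∈ pureProductStates a b) :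
    X.trace = 1 := by
  obtain ⟨⟨v, w⟩, ⟨hv, hw⟩, rfl⟩ := hX
  simp only [mem_sphere_iff_norm, sub_zero] at hv hw
  simp [trace_kronecker, trace_vecMulVec_star_self, hv, hw, -trace_vecMulVec]

theorem isSeparable_smul_of_mem_convexHull {a b : ℕ}
    {X : Matrix (Fin a × Fin b) (Fin a × Fin b) ℂ}
    (hX : X ∈ convexHull ℝ (pureProductStates a b)) {t : ℝ} (ht : 0 ≤ t) :
    (t • X).IsSeparable := by
  obtain ⟨ι, _, c, z, hc, -, hz, rfl⟩ := mem_convexHull_iff_exists_fintype.1 hX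
  choose p hp hpz using hz
  refine ⟨ι, inferInstance, fun i => (t * c i) • vecMulVec (p i).1 (star (p i).1.ofLp),
    fun i => vecMulVec (p i).2 (star (p i).2.ofLp),
    fun i => (posSemidef_vecMulVec_self_star _).smul (mul_nonneg ht (hc i)),
    fun i => posSemidef_vecMulVec_self_star _, ?_⟩
  simp only [Finset.smul_sum, smul_smul, ← hpz, smul_kronecker]

/-- A real-linear functional separating a non-separable positive semidefinite matrix from the
pure product states. -/
theorem exists_real_witness {a b : ℕ} {E : Matrix (Fin a × Fin b) (Fin a × Fin b) ℂ}
    (hE : E.PosSemidef) (hsep : ¬ E.IsSeparable) :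
    ∃ f : Matrix (Fin a × Fin b) (Fin a × Fin b) ℂ →ₗ[ℝ] ℝ,
      (∀ X ∈ pureProductStates a b, 0 < f X) ∧ f E < 0 := by
  obtain ⟨t, ht⟩ : ∃ t : ℝ, E.trace = t :=
    ⟨E.trace.re, (Complex.eq_re_of_ofReal_le (r := 0) (by simpa using hE.trace_nonneg))⟩
  have ht0 : 0 ≤ t := by simpa [ht] using hE.trace_nonneg
  have htpos : 0 < t := by
    refine ht0.lt_of_ne' fun h0 => hsep ?_
    have : E = 0 := hE.trace_eq_zero_iff.1 (by simp [ht, h0])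
    exact ⟨Empty, inferInstance, Empty.elim, Empty.elim, nofun, nofun, by simp [this]⟩
  have hnot : t⁻¹ • E ∉ convexHull ℝ (pureProductStates a b) := fun h => hsep <| by
    simpa [smul_smul, htpos.ne'] using isSeparable_smul_of_mem_convexHull h ht0
  have : LocallyConvexSpace ℝ (Matrix (Fin a × Fin b) (Fin a × Fin b) ℂ) :=
    inferInstanceAs (LocallyConvexSpace ℝ (Fin a × Fin b → Fin a × Fin b → ℂ))
  obtain ⟨f, u, hfE, hf⟩ := geometric_hahn_banach_point_closed (convex_convexHull ℝ _)
    (isCompact_pureProductStates a b).convexHull_of_finiteDimensional.isClosed hnot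
  refine ⟨f.toLinearMap - u • (Complex.reLm ∘ₗ Matrix.traceLinearMap _ ℝ ℂ),
    fun X hX => ?_, ?_⟩
  · simpa [trace_of_mem_pureProductStates hX] using hf X (subset_convexHull ℝ _ hX)
  · rw [map_smul, smul_eq_mul, inv_mul_lt_iff₀ htpos] at hfE
    simp [ht]
    linarith

/-- A Hermitian functional that is strictly positive on product vectors and negative on a given
non-separable positive semidefinite matrix (an entanglement witness). -/
theorem exists_witness {a b : ℕ} {E : Matrix (Fin a × Fin b) (Fin a × Fin b) ℂ}
    (hE : E.PosSemidef) (hsep : ¬ E.IsSeparable) :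
    ∃ h : Matrix (Fin a × Fin b) (Fin a × Fin b) ℂ →ₗ[ℂ] ℂ,
      (∀ X, h Xᴴ = star (h X)) ∧
      (∀ v w, v ≠ 0 → w ≠ 0 → 0 < h (vecMulVec v (star v) ⊗ₖ vecMulVec w (star w))) ∧
      h E < 0 := by
  obtain ⟨f, hf, hfE⟩ := exists_real_witness hE hsep
  let g : Matrix (Fin a × Fin b) (Fin a × Fin b) ℂ →ₗ[ℂ] ℂ := Module.Dual.extendRCLike f
  have hg : ∀ X, (g X).re = f X := fun X => Module.Dual.re_extendRCLike_apply (𝕜 := ℂ) f X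
  let h : Matrix (Fin a × Fin b) (Fin a × Fin b) ℂ →ₗ[ℂ] ℂ :=
    { toFun := fun X => g X + star (g Xᴴ)
      map_add' := fun X Y => by simp only [conjTranspose_add, map_add, star_add]; ring
      map_smul' := fun c X => by simp [mul_add] }
  have hh : ∀ X, h X = g X + star (g Xᴴ) := fun _ => rfl
  have hherm : ∀ X : Matrix (Fin a × Fin b) (Fin a × Fin b) ℂ, X.IsHermitian →
      h X = ((2 * f X : ℝ) : ℂ) := fun X hX => by
    rw [hh, hX.eq, ← hg]
    exact Complex.add_conj _
  have hpure : ∀ (v : EuclideanSpace ℂ (Fin a)) (w : EuclideanSpace ℂ (Fin b)), v ≠ 0 → w ≠ 0 →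
      0 < f (vecMulVec v (star v.ofLp) ⊗ₖ vecMulVec w (star w.ofLp)) := fun v w hv hw => by
    have hv' : 0 < ‖v‖ := norm_pos_iff.2 hv
    have hw' : 0 < ‖w‖ := norm_pos_iff.2 hw
    have := hf _ ⟨((‖v‖⁻¹ : ℝ) • v, (‖w‖⁻¹ : ℝ) • w),
      ⟨by simp [norm_smul, hv'.ne'], by simp [norm_smul, hw'.ne']⟩, rfl⟩
    simp only [WithLp.ofLp_smul, star_smul, vecMulVec_smul, smul_vecMulVec, smul_kronecker,
      kronecker_smul, map_smul, smul_eq_mul, star_trivial] at this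
    have hc : 0 < ‖v‖⁻¹ := inv_pos.2 hv'
    have hd : 0 < ‖w‖⁻¹ := inv_pos.2 hw'
    simpa only [mul_pos_iff_of_pos_left, hc, hd] using this
  refine ⟨h, fun X => ?_, fun v w hv hw => ?_, ?_⟩
  · simp [hh, add_comm]
  · rw [hherm _ ((posSemidef_vecMulVec_self_star v).kronecker
      (posSemidef_vecMulVec_self_star w)).isHermitian]
    have := hpure (WithLp.toLp 2 v) (WithLp.toLp 2 w) (by simpa using hv) (by simpa using hw)
    exact_mod_cast mul_pos two_pos this
  · rw [hherm _ hE.isHermitian]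
    have : 2 * f E < 0 := by linarith
    exact_mod_cast this

/-- The map associated with a functional on the bipartite system by the Choi–Jamiołkowski
correspondence. -/
def choiMap {a b : ℕ} (h : Matrix (Fin a × Fin b) (Fin a × Fin b) ℂ →ₗ[ℂ] ℂ) :
    Matrix (Fin a) (Fin a) ℂ →ₗ[ℂ] Matrix (Fin b) (Fin b) ℂ where
  toFun A := Matrix.of fun k l => h (A ⊗ₖ Matrix.single k l 1)
  map_add' A B := by ext; simp [add_kronecker]
  map_smul' c A := by ext; simp [smul_kronecker]

section choiMap

variable {a b : ℕ} {h : Matrix (Fin a × Fin b) (Fin a × Fin b) ℂ →ₗ[ℂ] ℂ}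

theorem choiMap_conjTranspose (hh : ∀ X, h Xᴴ = star (h X)) (X : Matrix (Fin a) (Fin a) ℂ) :
    choiMap h Xᴴ = (choiMap h X)ᴴ := by
  ext k l
  simp [choiMap, ← hh, conjTranspose_kronecker, -RCLike.star_def]

theorem dotProduct_choiMap_mulVec (A : Matrix (Fin a) (Fin a) ℂ) (w : Fin b → ℂ) :
    star w ⬝ᵥ (choiMap h A *ᵥ w) = h (A ⊗ₖ vecMulVec (star w) (star (star w))) := by
  have : vecMulVec (star w) (star (star w)) =
      ∑ k, ∑ l, (star (w k) * w l) • Matrix.single k l (1 : ℂ) := by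
    ext i j
    simp [vecMulVec_apply, Matrix.sum_apply, Matrix.single_apply, ite_and]
  have hsum : A ⊗ₖ vecMulVec (star w) (star (star w)) =
      ∑ k, ∑ l, (star (w k) * w l) • (A ⊗ₖ Matrix.single k l (1 : ℂ)) := by
    rw [this]
    ext p q
    simp only [kroneckerMap_apply, Matrix.sum_apply, Matrix.smul_apply, smul_eq_mul,
      Finset.mul_sum, mul_left_comm]
  rw [hsum]
  simp only [map_sum, map_smul, dotProduct, mulVec, Finset.mul_sum, choiMap]
  refine Finset.sum_congr rfl fun k _ => Finset.sum_congr rfl fun l _ => ?_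
  simp
  ring

theorem choiMap_vecMulVec_posDef (hh : ∀ X, h Xᴴ = star (h X))
    (hpos : ∀ v w, v ≠ 0 → w ≠ 0 → 0 < h (vecMulVec v (star v) ⊗ₖ vecMulVec w (star w)))
    {v : Fin a → ℂ} (hv : v ≠ 0) : (choiMap h (vecMulVec v (star v))).PosDef := by
  refine .of_dotProduct_mulVec_pos ?_ fun w hw => ?_
  · rw [IsHermitian, ← choiMap_conjTranspose hh, (posSemidef_vecMulVec_self_star v).isHermitian.eq]
  · rw [dotProduct_choiMap_mulVec]
    exact hpos _ _ hv (star_ne_zero.2 hw)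

theorem choiMap_posSemidef (hh : ∀ X, h Xᴴ = star (h X))
    (hpos : ∀ v w, v ≠ 0 → w ≠ 0 → 0 < h (vecMulVec v (star v) ⊗ₖ vecMulVec w (star w)))
    {X : Matrix (Fin a) (Fin a) ℂ} (hX : X.PosSemidef) : (choiMap h X).PosSemidef := by
  obtain ⟨m, v, rfl⟩ := posSemidef_iff_eq_sum_vecMulVec.1 hX
  rw [map_sum]
  refine posSemidef_sum _ fun i _ => ?_
  by_cases hv : v i = 0
  · simp [hv, PosSemidef.zero]
  · exact (choiMap_vecMulVec_posDef hh hpos hv).posSemidef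

theorem choiMap_one_posDef [NeZero a] (hh : ∀ X, h Xᴴ = star (h X))
    (hpos : ∀ v w, v ≠ 0 → w ≠ 0 → 0 < h (vecMulVec v (star v) ⊗ₖ vecMulVec w (star w))) :
    (choiMap h 1).PosDef := by
  have : (1 : Matrix (Fin a) (Fin a) ℂ) =
      ∑ i, vecMulVec (Pi.single i 1) (star (Pi.single i (1 : ℂ))) := by
    ext i j
    simp [Matrix.sum_apply, vecMulVec_apply, Matrix.one_apply, Pi.single_apply]
  rw [this, map_sum]
  exact posDef_sum Finset.univ_nonempty fun i _ => choiMap_vecMulVec_posDef hh hpos (by simp)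

theorem sum_choiMap_apply (E : Matrix (Fin a × Fin b) (Fin a × Fin b) ℂ) :
    ∑ k, ∑ l, choiMap h (Matrix.of fun i j => E (i, k) (j, l)) k l = h E := by
  have : E = ∑ k, ∑ l, (Matrix.of fun i j => E (i, k) (j, l)) ⊗ₖ Matrix.single k l (1 : ℂ) := by
    ext p q
    simp [Matrix.sum_apply, Matrix.single_apply, ite_and]
  conv_rhs => rw [this]
  simp [choiMap]

end choiMap

theorem dotProduct_partialMap_mulVec {a b : ℕ}
    (Ψ : Matrix (Fin a) (Fin a) ℂ →ₗ[ℂ] Matrix (Fin b) (Fin b) ℂ)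
    (E : Matrix (Fin a × Fin b) (Fin a × Fin b) ℂ) (C : Matrix (Fin b) (Fin b) ℂ) :
    star (fun p : Fin b × Fin b => star (C p.2 p.1)) ⬝ᵥ
        (partialMap Ψ E *ᵥ fun p => star (C p.2 p.1)) =
      ∑ k, ∑ l, (C * Ψ (Matrix.of fun i j => E (i, k) (j, l)) * Cᴴ) k l := by
  simp only [dotProduct, mulVec, partialMap, Fintype.sum_prod_type, Matrix.mul_apply,
    Finset.mul_sum, Finset.sum_mul, conjTranspose_apply, Pi.star_apply, star_star, of_apply]
  rw [Finset.sum_comm]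
  refine Finset.sum_congr rfl fun k _ => ?_
  rw [Finset.sum_comm]
  conv_rhs => rw [Finset.sum_comm]
  refine Finset.sum_congr rfl fun j _ => ?_
  rw [Finset.sum_comm]
  simp only [mul_assoc]

open scoped MatrixOrder in
theorem Matrix.isSeparable_of_partialMap_posSemidef {a b : ℕ}
    {E : Matrix (Fin a × Fin b) (Fin a × Fin b) ℂ} (hE : E.PosSemidef)
    (H : ∀ Ψ : Matrix (Fin a) (Fin a) ℂ →ₗ[ℂ] Matrix (Fin b) (Fin b) ℂ,
      (∀ X : Matrix (Fin a) (Fin a) ℂ, Ψ Xᴴ = (Ψ X)ᴴ) →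
      (∀ X : Matrix (Fin a) (Fin a) ℂ, X.PosSemidef → (Ψ X).PosSemidef) →
      Ψ 1 = 1 → (partialMap Ψ E).PosSemidef) : E.IsSeparable := by
  by_contra hsep
  obtain ⟨h, hh, hpos, hneg⟩ := exists_witness hE hsep
  have : NeZero a := ⟨by
    rintro rfl
    rw [Subsingleton.elim E 0, map_zero] at hneg
    exact hneg.false⟩
  have hP := choiMap_one_posDef hh hpos
  obtain ⟨C, hC, hPC⟩ : ∃ C : Matrix (Fin b) (Fin b) ℂ, IsUnit C ∧ choiMap h 1 = C * Cᴴ := by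
    obtain ⟨B, hB, hPB⟩ :=
      CStarAlgebra.isStrictlyPositive_iff_eq_star_mul_self.1 hP.isStrictlyPositive
    exact ⟨Bᴴ, (isUnit_conjTranspose _).2 hB, by rw [hPB, conjTranspose_conjTranspose]; rfl⟩
  have hdet : IsUnit C.det := (Matrix.isUnit_iff_isUnit_det C).1 hC
  let Ψ : Matrix (Fin a) (Fin a) ℂ →ₗ[ℂ] Matrix (Fin b) (Fin b) ℂ :=
    LinearMap.mulRight ℂ C⁻¹ᴴ ∘ₗ LinearMap.mulLeft ℂ C⁻¹ ∘ₗ choiMap h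
  have hΨ : ∀ X, Ψ X = C⁻¹ * choiMap h X * C⁻¹ᴴ := fun _ => rfl
  have hCinv : C⁻¹ᴴ * Cᴴ = 1 := by
    rw [← conjTranspose_mul, Matrix.mul_nonsing_inv _ hdet, conjTranspose_one]
  have hCinv' : Cᴴ * C⁻¹ᴴ = 1 := by
    rw [← conjTranspose_mul, Matrix.nonsing_inv_mul _ hdet, conjTranspose_one]
  have hback : ∀ X, C * Ψ X * Cᴴ = choiMap h X := fun X => by
    rw [hΨ, ← Matrix.mul_assoc, ← Matrix.mul_assoc, Matrix.mul_nonsing_inv _ hdet, Matrix.one_mul,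
      Matrix.mul_assoc, hCinv, Matrix.mul_one]
  have hpsd := H Ψ
    (fun X => by simp [hΨ, choiMap_conjTranspose hh, Matrix.mul_assoc])
    (fun X hX => (choiMap_posSemidef hh hpos hX).mul_mul_conjTranspose_same _)
    (by rw [hΨ, hPC, ← Matrix.mul_assoc, Matrix.nonsing_inv_mul _ hdet, Matrix.one_mul, hCinv'])
  have hnn := hpsd.dotProduct_mulVec_nonneg fun p => star (C p.2 p.1)
  rw [dotProduct_partialMap_mulVec] at hnn
  simp only [hback, sum_choiMap_apply] at hnn
  exact (hnn.trans_lt hneg).false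


theorem separable_iff_partially_transformable {a b M : ℕ}
    (e : Fin M → Matrix (Fin a × Fin b) (Fin a × Fin b) ℂ)
    (he_pos : ∀ m, (e m).PosSemidef)
    (he_sum : ∑ m, e m = 1) :
    (∀ m, (e m).IsSeparable) ↔
      (∀ (a' : ℕ) (Ψ : Matrix (Fin a) (Fin a) ℂ →ₗ[ℂ] Matrix (Fin a') (Fin a') ℂ),
        (∀ X : Matrix (Fin a) (Fin a) ℂ, Ψ Xᴴ = (Ψ X)ᴴ) →
        (∀ X : Matrix (Fin a) (Fin a) ℂ, X.PosSemidef → (Ψ X).PosSemidef) →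
        Ψ 1 = 1 →
        ∀ m, (partialMap Ψ (e m)).PosSemidef) := by
  exact ⟨fun h _ _ _ hpos _ m => (h m).partialMap_posSemidef hpos,
    fun H m => Matrix.isSeparable_of_partialMap_posSemidef (he_pos m)
      fun Ψ h₁ h₂ h₃ => H b Ψ h₁ h₂ h₃ m⟩
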